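/- Let T be an open simplex and T' a nonempty closed simplex, on disjoint vertex sets. Then sd(T * T') carries a Morse shelling which begins with the derived neighborhood N(T, T * T'). Moreover, this shelling uses exactly one critical tile contained in N(T, T * T'), of index dim(T), and exactly one critical tile outside N(T, T * T'), of index dim(T) + 1, and no other critical tiles. -/

import Mathlib

/-!
Common combinatorial framework for Morse shellings of simplicial complexes,
following J.-Y. Welschinger, "Morse shellings out of discrete Morse functions".
-/

namespace MorseShelling

variable {V : Type*} [DecidableEq V] {W : Type*} [DecidableEq W]

/-- A (finite, combinatorial) simplicial complex: a downward-closed collection of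
finite subsets (simplices) of the vertex type. -/
def IsComplex (K : Finset (Finset V)) : Prop :=
  ∀ σ ∈ K, ∀ τ ⊆ σ, τ ∈ K

/-- A relative simplicial complex `S = K \ L`, recorded as the pair `(K, L)`. -/
structure RelCplx (V : Type*) where
  K : Finset (Finset V)
  L : Finset (Finset V)

/-- The faces of a relative simplicial complex. -/
def RelCplx.faces (S : RelCplx V) : Finset (Finset V) := S.K \ S.L

/-- Validity of a relative simplicial complex: both members are complexes and
`L` is a subcomplex of `K`. -/
def RelCplx.IsValid (S : RelCplx V) : Prop :=
  IsComplex S.K ∧ IsComplex S.L ∧ S.L ⊆ S.K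

/-- Join of two collections of faces (on disjoint vertex supports). -/
def joinF (K₁ K₂ : Finset (Finset V)) : Finset (Finset V) :=
  (K₁ ×ˢ K₂).image fun p => p.1 ∪ p.2

/-- Join of two relative simplicial complexes:
`(K₁ * K₂) \ ((L₁ * K₂) ∪ (K₁ * L₂))`. -/
def RelCplx.join (S₁ S₂ : RelCplx V) : RelCplx V :=
  ⟨joinF S₁.K S₂.K, joinF S₁.L S₂.K ∪ joinF S₁.K S₂.L⟩

/-- The star of a simplex `σ` in `K` : all faces `τ` with `σ ∪ τ ∈ K`. -/
def star (K : Finset (Finset V)) (σ : Finset V) : Finset (Finset V) :=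
  K.filter fun τ => σ ∪ τ ∈ K

/-- The link of a simplex `σ` in `K` : all faces `τ` of the star disjoint from `σ`. -/
def link (K : Finset (Finset V)) (σ : Finset V) : Finset (Finset V) :=
  K.filter fun τ => σ ∪ τ ∈ K ∧ σ ∩ τ = ∅

/-- The star of a simplex in a relative complex, `st_S(σ) = st_K(σ) \ st_L(σ)`. -/
def RelCplx.starR (S : RelCplx V) (σ : Finset V) : RelCplx V :=
  ⟨star S.K σ, star S.L σ⟩

/-- The link of a simplex in a relative complex, `lk_S(σ) = lk_K(σ) \ lk_L(σ)`. -/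
def RelCplx.linkR (S : RelCplx V) (σ : Finset V) : RelCplx V :=
  ⟨link S.K σ, link S.L σ⟩

/-- The boundary complex of a simplex: all its proper faces (including `∅`). -/
def boundary (σ : Finset V) : Finset (Finset V) := σ.powerset.erase σ

/-- First barycentric subdivision: the faces are the (possibly empty) flags
`∅ ≠ σ₀ ⊊ σ₁ ⊊ ... ⊊ σ_q` of nonempty faces of `K`, a nonempty face `σ` of `K`
becoming the vertex `σ̂ = σ`. By convention `sd ∅ = ∅`. -/
def sd (K : Finset (Finset V)) : Finset (Finset (Finset V)) :=
  if K = ∅ then ∅ else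
    (K.erase ∅).powerset.filter fun c => ∀ a ∈ c, ∀ b ∈ c, a ⊆ b ∨ b ⊆ a

/-- First barycentric subdivision of a relative complex: `sd (K \ L) = sd K \ sd L`. -/
def RelCplx.sdR (S : RelCplx V) : RelCplx (Finset V) := ⟨sd S.K, sd S.L⟩

/-- An (absolute) simplicial complex seen as a relative one. -/
def toRel (K : Finset (Finset V)) : RelCplx V := ⟨K, ∅⟩

/-- The vertex support of a relative complex. -/
def suppK (S : RelCplx V) : Finset V := S.K.sup id

/-- The ridges (codimension one faces) of a simplex. -/
def ridges (σ : Finset V) : Finset (Finset V) := σ.image fun v => σ.erase v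

/-- The subcomplex of the simplex `σ` consisting of the faces contained in some
member of `R`. -/
def below (σ : Finset V) (R : Finset (Finset V)) : Finset (Finset V) :=
  σ.powerset.filter fun τ => ∃ ρ ∈ R, τ ⊆ ρ

/-- The restriction set of the basic tile `σ \ R`: the face spanned by the
vertices opposite to the missing ridges `R`. -/
def restSet (σ : Finset V) (R : Finset (Finset V)) : Finset V :=
  σ.filter fun v => σ.erase v ∈ R

/-- A basic tile of dimension `n` and order `k`: an `n`-simplex deprived of `k`
of its ridges (together with all the faces contained in them). -/
def IsBasicTile (S : RelCplx V) (n k : ℕ) : Prop :=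
  ∃ σ : Finset V, σ.card = n + 1 ∧ S.K = σ.powerset ∧
    ∃ R ⊆ ridges σ, R.card = k ∧ S.L = below σ R

/-- A Morse tile of dimension `n` and order `k`: a basic tile, possibly further
deprived of a unique face of higher codimension (its Morse face). -/
def IsMorseTile (S : RelCplx V) (n k : ℕ) : Prop :=
  ∃ σ : Finset V, σ.card = n + 1 ∧ S.K = σ.powerset ∧
    ∃ R ⊆ ridges σ, R.card = k ∧
      (S.L = below σ R ∨
        ∃ μ ⊆ σ, μ ∉ below σ R ∧ μ.card + 2 ≤ σ.card ∧
          S.L = below σ R ∪ below σ {μ})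

/-- A critical tile of dimension `n` and index `k`: either a closed simplex
(index `0`), or a basic tile of order `k` deprived of its restriction set
(this includes the dotted simplex for `k = 0` and the open simplex for `k = n`). -/
def IsCriticalTile (S : RelCplx V) (n k : ℕ) : Prop :=
  ∃ σ : Finset V, σ.card = n + 1 ∧ S.K = σ.powerset ∧
    ((k = 0 ∧ S.L = ∅) ∨
      (k ≤ n ∧ ∃ R ⊆ ridges σ, R.card = k ∧
        S.L = below σ R ∪ below σ {restSet σ R}))

/-- A closed simplex, as a tile. -/
def IsClosedSimplexTile (S : RelCplx V) : Prop :=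
  ∃ σ : Finset V, S.K = σ.powerset ∧ S.L = ∅

/-- An open simplex, as a tile: deprived of its whole boundary, incl. the empty face. -/
def IsOpenSimplexTile (S : RelCplx V) : Prop :=
  ∃ σ : Finset V, σ ≠ ∅ ∧ S.K = σ.powerset ∧ S.L = σ.powerset.erase σ

/-- The closed simplex on vertex set `σ`, as a relative complex. -/
def closedT (σ : Finset V) : RelCplx V := ⟨σ.powerset, ∅⟩

/-- The open simplex on vertex set `σ`. -/
def openT (σ : Finset V) : RelCplx V := ⟨σ.powerset, σ.powerset.erase σ⟩

/-- The closed simplex deprived of its empty face, `σ̇` (the neutral tile when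
`σ = ∅`, so that empty factors may be dropped from joins). -/
def dotT (σ : Finset V) : RelCplx V := ⟨σ.powerset, if σ = ∅ then ∅ else {∅}⟩

/-- The Morse tile `σ * θ̊ * τ̇`. -/
def splitTile (σ θ τ : Finset V) : RelCplx V :=
  (closedT σ).join ((openT θ).join (dotT τ))

/-- A tiling of a relative simplicial complex by `N` relative facets: the tiles
are relative simplices whose underlying simplices are facets, and their faces
partition the faces of `S`. -/
structure Tiling (S : RelCplx W) (N : ℕ) where
  tile : Fin N → RelCplx W
  isFacet : ∀ i, ∃ σ ∈ S.K, (∀ τ ∈ S.K, σ ⊆ τ → τ = σ) ∧ (tile i).K = σ.powerset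
  subL : ∀ i, (tile i).L ⊆ (tile i).K
  disj : ∀ i j, i ≠ j → Disjoint (tile i).faces (tile j).faces
  cover : (Finset.univ : Finset (Fin N)).biUnion (fun i => (tile i).faces) = S.faces

/-- The union of the faces of the first `p` tiles of a tiling. -/
def Tiling.prefixFaces {S : RelCplx W} {N : ℕ} (T : Tiling S N) (p : ℕ) :
    Finset (Finset W) :=
  (Finset.univ.filter fun i : Fin N => (i : ℕ) < p).biUnion fun i => (T.tile i).faces

/-- A tiling is a shelling when each of the sets of faces of `S_p = K_p \ L`
is a relative subcomplex, i.e. `L ∪ (tiles of index < p)` is a complex. -/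
def Tiling.IsShelling {S : RelCplx W} {N : ℕ} (T : Tiling S N) : Prop :=
  ∀ p ≤ N, IsComplex (S.L ∪ T.prefixFaces p)

/-- A (shelled) tiling begins with a set `F` of faces when some initial segment
of its tiles partitions exactly `F`. -/
def Tiling.BeginsWith {S : RelCplx W} {N : ℕ} (T : Tiling S N)
    (F : Finset (Finset W)) : Prop :=
  ∃ p ≤ N, T.prefixFaces p = F

/-- A Morse tiling: all tiles are Morse tiles. -/
def Tiling.IsMorse {S : RelCplx W} {N : ℕ} (T : Tiling S N) : Prop :=
  ∀ i, ∃ n k, IsMorseTile (T.tile i) n k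

/-- An h-tiling: all tiles are basic or critical tiles. -/
def Tiling.IsH {S : RelCplx W} {N : ℕ} (T : Tiling S N) : Prop :=
  ∀ i, (∃ n k, IsBasicTile (T.tile i) n k) ∨ (∃ n k, IsCriticalTile (T.tile i) n k)

/-- `f` induces a simplicial isomorphism from `A` onto `B` (both viewed through
their collections of faces). -/
def IsSimplicialIso (f : V → W) (A : Finset (Finset V)) (B : Finset (Finset W)) : Prop :=
  Set.BijOn (fun σ : Finset V => σ.image f) ↑A ↑B

/-- `f` induces an isomorphism of relative simplicial complexes. -/
def IsRelIso (f : V → W) (S : RelCplx V) (S' : RelCplx W) : Prop :=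
  Set.BijOn (fun σ : Finset V => σ.image f) ↑S.K ↑S'.K ∧
    Set.BijOn (fun σ : Finset V => σ.image f) ↑S.L ↑S'.L

/-- The first derived neighborhood `N(L, K)` of a subcomplex `L` in `K` : the union
of the stars in `sd K` of the vertices of `L`. -/
def derivedNbhd (L K : Finset (Finset V)) : Finset (Finset (Finset V)) :=
  (L.filter fun s => s.card = 1).biUnion fun s => star (sd K) {s}

/-- The faces of the derived neighborhood `N(T, S)` of a tile `T` in a relative
complex `S`: the union of the relative stars in `sd S` of the vertices of `T`. -/
def relDerivedNbhd (T S : RelCplx V) : Finset (Finset (Finset V)) :=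
  ((suppK T).biUnion fun v => ((S.sdR).starR {({v} : Finset V)}).faces) ∩ (S.sdR).faces

/-- A discrete Morse function on the finite simplicial complex `K`. -/
def IsDiscreteMorse (K : Finset (Finset V)) (f : Finset V → ℝ) : Prop :=
  ∀ σ ∈ K, σ ≠ ∅ →
    (K.filter fun τ => σ ⊂ τ ∧ f τ ≤ f σ).card ≤ 1 ∧
    (K.filter fun θ => θ ≠ ∅ ∧ θ ⊂ σ ∧ f σ ≤ f θ).card ≤ 1

/-- A critical face of a discrete Morse function. -/
def IsCriticalFace (K : Finset (Finset V)) (f : Finset V → ℝ) (σ : Finset V) : Prop :=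
  σ ∈ K ∧ σ ≠ ∅ ∧ (∀ τ ∈ K, σ ⊂ τ → f σ < f τ) ∧
    ∀ θ ∈ K, θ ≠ ∅ → θ ⊂ σ → f θ < f σ

/-- An elementary collapse: removal of a facet `τ` together with a ridge `θ` of it
contained in no other facet. -/
def ElementaryCollapse (K K' : Finset (Finset V)) : Prop :=
  ∃ τ ∈ K, ∃ θ ∈ K, θ ⊆ τ ∧ τ.card = θ.card + 1 ∧
    (∀ ρ ∈ K, τ ⊆ ρ → ρ = τ) ∧
    (∀ ρ ∈ K, θ ⊆ ρ → ρ = θ ∨ ρ = τ) ∧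
    K' = (K.erase τ).erase θ

/-- A finite simplicial complex is collapsible when some finite sequence of
elementary collapses reduces it to a single vertex. -/
def Collapsible (K : Finset (Finset V)) : Prop :=
  ∃ v : V, Relation.ReflTransGen ElementaryCollapse K {∅, {v}}

set_option linter.unusedSectionVars false

/-- The relative simplex on `f` whose faces contain `r` and have a vertex satisfying `P`. -/
def resTile (f r : Finset W) (P : W → Prop) [DecidablePred P] : RelCplx W :=
  ⟨f.powerset, f.powerset.filter fun c => ¬(r ⊆ c ∧ ∃ u ∈ c, P u)⟩

theorem mem_resTile_faces {f r : Finset W} {P : W → Prop} [DecidablePred P] {c : Finset W} :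
    c ∈ (resTile f r P).faces ↔ c ⊆ f ∧ r ⊆ c ∧ ∃ u ∈ c, P u := by
  simp only [RelCplx.faces, resTile, Finset.mem_sdiff, Finset.mem_powerset, Finset.mem_filter]
  refine and_congr_right fun hc => ?_
  simp only [hc, true_and, not_not]

theorem subset_erase_iff_notMem {c f : Finset W} {v : W} (hc : c ⊆ f) :
    c ⊆ f.erase v ↔ v ∉ c :=
  ⟨fun h hv => Finset.notMem_erase v f (h hv), fun h => Finset.subset_erase.2 ⟨hc, h⟩⟩

theorem mem_below_image_erase {f s c : Finset W} :
    c ∈ below f (s.image fun v => f.erase v) ↔ c ⊆ f ∧ ¬ s ⊆ c := by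
  simp only [below, Finset.mem_filter, Finset.mem_powerset, Finset.mem_image,
    exists_exists_and_eq_and, Finset.not_subset]
  refine and_congr_right fun hc => exists_congr fun v => and_congr_right fun _ => ?_
  exact subset_erase_iff_notMem hc

theorem erase_injOn (f : Finset W) : Set.InjOn (fun v => f.erase v) (f : Set W) := by
  intro a ha b hb h
  by_contra hab
  have : a ∈ f.erase b := Finset.mem_erase.2 ⟨hab, ha⟩
  exact Finset.notMem_erase a f (by simpa only [h] using this)

theorem card_image_erase {f s : Finset W} (hs : s ⊆ f) :
    (s.image fun v => f.erase v).card = s.card :=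
  Finset.card_image_of_injOn ((erase_injOn f).mono (by exact_mod_cast hs))

theorem restSet_image_erase {f s : Finset W} (hs : s ⊆ f) :
    restSet f (s.image fun v => f.erase v) = s := by
  ext v
  simp only [restSet, Finset.mem_filter, Finset.mem_image]
  constructor
  · rintro ⟨hv, a, ha, h⟩
    rwa [← erase_injOn f (hs ha) hv h]
  · exact fun hv => ⟨hs hv, v, hv, rfl⟩

theorem mem_below_singleton {f m c : Finset W} : c ∈ below f {m} ↔ c ⊆ f ∧ c ⊆ m := by
  simp [below]

theorem exists_image_erase_of_subset_ridges {f : Finset W} {R : Finset (Finset W)}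
    (hR : R ⊆ ridges f) : ∃ s ⊆ f, R = s.image fun v => f.erase v := by
  refine ⟨restSet f R, Finset.filter_subset _ _, ?_⟩
  ext ρ
  simp only [restSet, Finset.mem_image, Finset.mem_filter]
  constructor
  · intro h
    obtain ⟨v, hv, rfl⟩ := Finset.mem_image.1 (hR h)
    exact ⟨v, ⟨hv, h⟩, rfl⟩
  · rintro ⟨v, ⟨_, h⟩, rfl⟩
    exact h

theorem isMorseTile_resTile {f r : Finset W} {P : W → Prop} [DecidablePred P] (hr : r ⊆ f)
    (hP : ∃ u ∈ f, P u) : ∃ n k, IsMorseTile (resTile f r P) n k := by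
  obtain ⟨u, huf, hu⟩ := hP
  have hcard : f.card = (f.card - 1) + 1 := by
    have := Finset.card_pos.2 ⟨u, huf⟩
    omega
  have hridge : ∀ s ⊆ f, (s.image fun v => f.erase v) ⊆ ridges f := fun s hs =>
    Finset.image_subset_image hs
  by_cases h1 : ∃ v ∈ r, P v
  · obtain ⟨v, hv, hPv⟩ := h1
    refine ⟨_, _, f, hcard, rfl, r.image fun v => f.erase v, hridge r hr, rfl, Or.inl ?_⟩
    ext c
    simp only [mem_below_image_erase, resTile, Finset.mem_filter, Finset.mem_powerset]
    refine and_congr_right fun _ => not_congr ⟨fun h => h.1, fun h => ⟨h, v, h hv, hPv⟩⟩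
  by_cases h2 : ∀ v ∈ f, P v → v = u
  · refine ⟨_, _, f, hcard, rfl, (insert u r).image fun v => f.erase v,
      hridge _ (Finset.insert_subset huf hr), rfl, Or.inl ?_⟩
    ext c
    simp only [mem_below_image_erase, resTile, Finset.mem_filter, Finset.mem_powerset,
      Finset.insert_subset_iff]
    refine and_congr_right fun hc => not_congr ⟨?_, fun h => ⟨h.2, u, h.1, hu⟩⟩
    rintro ⟨h, v, hv, hPv⟩
    exact ⟨h2 v (hc hv) hPv ▸ hv, h⟩
  push Not at h1 h2
  obtain ⟨v, hvf, hv, hvu⟩ := h2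
  refine ⟨_, _, f, hcard, rfl, r.image fun v => f.erase v, hridge r hr, rfl,
    Or.inr ⟨f.filter fun v => ¬ P v, Finset.filter_subset _ _, ?_, ?_, ?_⟩⟩
  · rw [mem_below_image_erase]
    exact fun h => h.2 fun x hx => Finset.mem_filter.2 ⟨hr hx, h1 x hx⟩
  · have h3 : ({u, v} : Finset W) ⊆ f.filter P := by
      intro x hx
      rcases Finset.mem_insert.1 hx with rfl | hx
      · exact Finset.mem_filter.2 ⟨huf, hu⟩
      · rw [Finset.mem_singleton.1 hx]
        exact Finset.mem_filter.2 ⟨hvf, hv⟩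
    have h4 := Finset.card_le_card h3
    rw [Finset.card_pair hvu.symm] at h4
    have h5 := Finset.card_filter_add_card_filter_not (s := f) P
    omega
  · ext c
    simp only [Finset.mem_union, mem_below_image_erase, mem_below_singleton, resTile,
      Finset.mem_filter, Finset.mem_powerset, ← and_or_left]
    refine and_congr_right fun hc => ?_
    rw [not_and_or]
    refine or_congr Iff.rfl ?_
    push Not
    exact ⟨fun h x hx => Finset.mem_filter.2 ⟨hc hx, h x hx⟩,
      fun h x hx => (Finset.mem_filter.1 (h hx)).2⟩

theorem isCriticalTile_resTile {f r : Finset W} {P : W → Prop} [DecidablePred P]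
    (hr : r = f.filter fun v => ¬ P v) (hP : ∃ u ∈ f, P u) :
    ∃ n, IsCriticalTile (resTile f r P) n r.card := by
  obtain ⟨u, huf, hu⟩ := hP
  have hrf : r ⊆ f := hr ▸ Finset.filter_subset _ _
  have hur : u ∉ r := fun h => by
    rw [hr] at h
    exact (Finset.mem_filter.1 h).2 hu
  have hlt : r.card < f.card := Finset.card_lt_card ⟨hrf, fun h => hur (h huf)⟩
  refine ⟨f.card - 1, f, by omega, rfl, Or.inr ⟨by omega, r.image fun v => f.erase v,
    Finset.image_subset_image hrf, card_image_erase hrf, ?_⟩⟩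
  rw [restSet_image_erase hrf]
  ext c
  simp only [Finset.mem_union, mem_below_image_erase, mem_below_singleton, resTile,
    Finset.mem_filter, Finset.mem_powerset, ← and_or_left]
  refine and_congr_right fun hc => ?_
  rw [not_and_or]
  refine or_congr Iff.rfl ?_
  push Not
  rw [hr]
  exact ⟨fun h x hx => Finset.mem_filter.2 ⟨hc hx, h x hx⟩,
    fun h x hx => (Finset.mem_filter.1 (h hx)).2⟩

theorem eq_filter_not_of_isCriticalTile_resTile {f r : Finset W} {P : W → Prop}
    [DecidablePred P] (hrf : r ⊆ f) (hne : r ≠ f) (hP : ∃ u ∈ f, P u) {n k : ℕ}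
    (h : IsCriticalTile (resTile f r P) n k) : r = f.filter fun v => ¬ P v := by
  obtain ⟨σ, hcard, hK, h⟩ := h
  obtain rfl : f = σ := Finset.powerset_injective hK
  obtain ⟨u, huf, hu⟩ := hP
  rcases h with ⟨-, hL⟩ | ⟨hk, R, hR, hRk, hL⟩
  · have : (∅ : Finset W) ∈ (resTile f r P).L := by simp [resTile]
    simp [hL] at this
  obtain ⟨A, hA, rfl⟩ := exists_image_erase_of_subset_ridges hR
  rw [restSet_image_erase hA] at hL
  rw [card_image_erase hA] at hRk
  have key : ∀ c ⊆ f, (r ⊆ c ∧ ∃ u ∈ c, P u) ↔ (A ⊆ c ∧ ¬ c ⊆ A) := by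
    intro c hc
    have := congrArg (fun s => c ∈ s) hL
    simp only [Finset.mem_union, mem_below_image_erase, mem_below_singleton, resTile,
      Finset.mem_filter, Finset.mem_powerset, hc, true_and, eq_iff_iff] at this
    rw [← not_iff_not, this, not_and_or, not_not]
  have hAf : ∃ a ∈ f, a ∉ A := by
    by_contra! h
    have := Finset.card_le_card (show f ⊆ A from h)
    omega
  obtain ⟨a, haf, haA⟩ := hAf
  have hins : ∀ x ∈ f, x ∉ A → r ⊆ insert x A ∧ ∃ u ∈ insert x A, P u := fun x hx hxA =>
    (key _ (Finset.insert_subset hx hA)).2 ⟨Finset.subset_insert _ _,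
      fun h => hxA (h (Finset.mem_insert_self _ _))⟩
  have hrins : ∀ x ∈ f, P x → A ⊆ insert x r ∧ ¬ insert x r ⊆ A := fun x hx hPx =>
    (key _ (Finset.insert_subset hx hrf)).1 ⟨Finset.subset_insert _ _, x,
      Finset.mem_insert_self _ _, hPx⟩
  have hrP : ∀ x ∈ r, ¬ P x := by
    intro x hx hPx
    have h1 := hrins x (hrf hx) hPx
    rw [Finset.insert_eq_of_mem hx] at h1
    obtain ⟨y, hyr, hyA⟩ := Finset.not_subset.1 h1.2
    have hall : ∀ z ∈ f, z ∉ A → z = y := by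
      intro z hz hzA
      rcases Finset.mem_insert.1 ((hins z hz hzA).1 hyr) with h | h
      · exact h.symm
      · exact absurd h hyA
    refine hne (Finset.Subset.antisymm hrf fun z hz => ?_)
    by_cases hzA : z ∈ A
    · exact h1.1 hzA
    · exact hall z hz hzA ▸ hyr
  refine Finset.Subset.antisymm (fun x hx => Finset.mem_filter.2 ⟨hrf hx, hrP x hx⟩)
    fun x hx => ?_
  obtain ⟨hxf, hPx⟩ := Finset.mem_filter.1 hx
  obtain ⟨hAu, huA⟩ := hrins u huf hu
  by_cases hb : ∃ b ∈ f, b ∉ A ∧ b ≠ a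
  · obtain ⟨b, hbf, hbA, hba⟩ := hb
    have hrA : r ⊆ A := by
      intro z hz
      rcases Finset.mem_insert.1 ((hins a haf haA).1 hz) with h1 | h1
      · rcases Finset.mem_insert.1 ((hins b hbf hbA).1 hz) with h2 | h2
        · exact absurd (h2.symm.trans h1) hba
        · exact h2
      · exact h1
    have hAP : ∀ v ∈ A, ¬ P v := fun v hv hPv =>
      ((key A hA).1 ⟨hrA, v, hv, hPv⟩).2 (Finset.Subset.refl A)
    by_cases hxA : x ∈ A
    · rcases Finset.mem_insert.1 (hAu hxA) with h1 | h1
      · exact absurd (h1 ▸ hu) hPx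
      · exact h1
    · obtain ⟨y, hy, hPy⟩ := (hins x hxf hxA).2
      rcases Finset.mem_insert.1 hy with h1 | h1
      · exact absurd (h1 ▸ hPy) hPx
      · exact absurd hPy (hAP y h1)
  · push Not at hb
    obtain ⟨y, hy, hyA⟩ := Finset.not_subset.1 huA
    have hya : y = a := hb y (Finset.insert_subset huf hrf hy) hyA
    have hx' : x ∈ insert u r := by
      by_cases hxA : x ∈ A
      · exact hAu hxA
      · rw [hb x hxf hxA, ← hya]
        exact hy
    rcases Finset.mem_insert.1 hx' with h1 | h1
    · exact absurd (h1 ▸ hu) hPx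
    · exact h1

/-- A shelling from an enumeration of facets `f i` with restriction sets `r i`, the removed
subcomplex consisting of the faces without vertices satisfying `P`. -/
theorem exists_tiling_resTile {S : RelCplx W} {N : ℕ} {f r : Fin N → Finset W} {P : W → Prop}
    [DecidablePred P] (hK : IsComplex S.K) (hL : IsComplex S.L)
    (hS : ∀ c, c ∈ S.faces ↔ c ∈ S.K ∧ ∃ u ∈ c, P u)
    (hf : ∀ i, f i ∈ S.K ∧ ∀ c ∈ S.K, f i ⊆ c → c = f i)
    (hcover : ∀ c ∈ S.K, ∃ i, c ⊆ f i)
    (hprev : ∀ i, ∀ v ∈ r i, ∃ j < i, (f i).erase v ⊆ f j)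
    (hrest : ∀ i, ∀ j < i, ∃ v ∈ r i, v ∉ f j) :
    ∃ T : Tiling S N, T.IsShelling ∧ ∀ i, T.tile i = resTile (f i) (r i) P := by
  have hmin : ∀ c ∈ S.faces, ∃ i, c ∈ (resTile (f i) (r i) P).faces ∧ ∀ j, c ⊆ f j → i ≤ j := by
    intro c hc
    obtain ⟨hcK, hcP⟩ := (hS c).1 hc
    obtain ⟨i, hi, himin⟩ := WellFounded.has_min (wellFounded_lt (α := Fin N))
      {i | c ⊆ f i} (hcover c hcK)
    have himin' : ∀ j, c ⊆ f j → i ≤ j := fun j hj => not_lt.1 (himin j hj)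
    refine ⟨i, mem_resTile_faces.2 ⟨hi, fun v hv => ?_, hcP⟩, himin'⟩
    by_contra hvc
    obtain ⟨j, hj, hsub⟩ := hprev i v hv
    exact (himin' j (((subset_erase_iff_notMem hi).2 hvc).trans hsub)).not_gt hj
  have hdisj : ∀ i j, j < i → Disjoint (resTile (f i) (r i) P).faces
      (resTile (f j) (r j) P).faces := by
    intro i j hj
    refine Finset.disjoint_left.2 fun c hc hc' => ?_
    obtain ⟨v, hv, hvj⟩ := hrest i j hj
    exact hvj ((mem_resTile_faces.1 hc').1 ((mem_resTile_faces.1 hc).2.1 hv))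
  have hsub : ∀ i, (resTile (f i) (r i) P).faces ⊆ S.faces := by
    intro i c hc
    obtain ⟨h1, -, h3⟩ := mem_resTile_faces.1 hc
    exact (hS c).2 ⟨hK _ (hf i).1 _ h1, h3⟩
  refine ⟨⟨fun i => resTile (f i) (r i) P, fun i => ⟨f i, (hf i).1, (hf i).2, rfl⟩,
    fun i => Finset.filter_subset _ _, ?_, ?_⟩, ?_, fun i => rfl⟩
  · intro i j hij
    rcases lt_or_gt_of_ne hij with h | h
    · exact (hdisj j i h).symm
    · exact hdisj i j h
  · ext c
    simp only [Finset.mem_biUnion, Finset.mem_univ, true_and]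
    constructor
    · rintro ⟨i, hi⟩
      exact hsub i hi
    · intro hc
      obtain ⟨i, hi, -⟩ := hmin c hc
      exact ⟨i, hi⟩
  · intro p _ c hc d hd
    rcases Finset.mem_union.1 hc with hc | hc
    · exact Finset.mem_union_left _ (hL c hc d hd)
    · simp only [Tiling.prefixFaces, Finset.mem_biUnion, Finset.mem_filter, Finset.mem_univ,
        true_and] at hc
      obtain ⟨i, hip, hi⟩ := hc
      by_cases hdL : d ∈ S.L
      · exact Finset.mem_union_left _ hdL
      have hcf := (mem_resTile_faces.1 hi).1
      have hdS : d ∈ S.faces :=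
        Finset.mem_sdiff.2 ⟨hK _ (hf i).1 _ (hd.trans hcf), hdL⟩
      obtain ⟨j, hj, hjmin⟩ := hmin d hdS
      refine Finset.mem_union_right _ ?_
      simp only [Tiling.prefixFaces, Finset.mem_biUnion, Finset.mem_filter, Finset.mem_univ,
        true_and]
      exact ⟨j, lt_of_le_of_lt (hjmin i (hd.trans hcf)) hip, hj⟩

theorem exists_forall_lt_iff {N : ℕ} {Q : Fin N → Prop} (hQ : ∀ i j, i ≤ j → Q j → Q i) :
    ∃ p ≤ N, ∀ i : Fin N, (i : ℕ) < p ↔ Q i := by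
  by_cases h : ∃ i, ¬ Q i
  · obtain ⟨i, hi, hmin⟩ := WellFounded.has_min (wellFounded_lt (α := Fin N)) {i | ¬ Q i} h
    refine ⟨i, i.2.le, fun j => ⟨fun hj => by_contra fun hn => hmin j hn hj, fun hj => ?_⟩⟩
    by_contra hn
    exact hi (hQ i j (not_lt.1 hn) hj)
  · push Not at h
    exact ⟨N, le_rfl, fun i => ⟨fun _ => h i, fun _ => i.2⟩⟩

theorem mem_sd {K : Finset (Finset V)} (hK : K ≠ ∅) {c : Finset (Finset V)} :
    c ∈ sd K ↔ (∀ a ∈ c, a.Nonempty ∧ a ∈ K) ∧ ∀ a ∈ c, ∀ b ∈ c, a ⊆ b ∨ b ⊆ a := by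
  simp only [sd, hK, if_false, Finset.mem_filter, Finset.mem_powerset, Finset.subset_iff,
    Finset.mem_erase, Finset.nonempty_iff_ne_empty]

theorem isComplex_sd (K : Finset (Finset V)) : IsComplex (sd K) := by
  intro c hc d hd
  have hK : K ≠ ∅ := by
    rintro rfl
    simp [sd] at hc
  rw [mem_sd hK] at hc ⊢
  exact ⟨fun a ha => hc.1 a (hd ha), fun a ha b hb => hc.2 a (hd ha) b (hd hb)⟩

section flags

variable {X : Finset V} {n : ℕ}

/-- The set of the elements in positions `0, …, i` of an enumeration of `X`. -/
def initSeg (w : Fin (n + 1) ≃ X) (i : Fin (n + 1)) : Finset V :=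
  (Finset.Iic i).image fun j => (w j : V)

/-- The maximal flag of nonempty subsets of `X` given by an enumeration of `X`. -/
def flag (w : Fin (n + 1) ≃ X) : Finset (Finset V) := Finset.univ.image (initSeg w)

theorem coe_injective (w : Fin (n + 1) ≃ X) : Function.Injective fun j => (w j : V) :=
  Subtype.val_injective.comp w.injective

theorem coe_mem_initSeg (w : Fin (n + 1) ≃ X) (i j : Fin (n + 1)) :
    (w j : V) ∈ initSeg w i ↔ j ≤ i := by
  simp only [initSeg, Finset.mem_image, Finset.mem_Iic]
  exact ⟨fun ⟨k, hk, h⟩ => coe_injective w h ▸ hk, fun h => ⟨j, h, rfl⟩⟩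

theorem exists_coe_eq (w : Fin (n + 1) ≃ X) {x : V} (hx : x ∈ X) : ∃ j, (w j : V) = x :=
  ⟨w.symm ⟨x, hx⟩, by simp⟩

theorem initSeg_subset (w : Fin (n + 1) ≃ X) (i : Fin (n + 1)) : initSeg w i ⊆ X := by
  intro x hx
  obtain ⟨j, -, rfl⟩ := Finset.mem_image.1 hx
  exact (w j).2

theorem card_initSeg (w : Fin (n + 1) ≃ X) (i : Fin (n + 1)) :
    (initSeg w i).card = (i : ℕ) + 1 := by
  rw [initSeg, Finset.card_image_of_injective _ (coe_injective w), Fin.card_Iic]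

theorem initSeg_mono (w : Fin (n + 1) ≃ X) : Monotone (initSeg w) := fun _ _ h =>
  Finset.image_subset_image (Finset.Iic_subset_Iic.2 h)

theorem initSeg_injective (w : Fin (n + 1) ≃ X) : Function.Injective (initSeg w) := by
  intro i j h
  have := congrArg Finset.card h
  rw [card_initSeg, card_initSeg] at this
  exact Fin.ext (by omega)

theorem initSeg_last (w : Fin (n + 1) ≃ X) : initSeg w (Fin.last n) = X := by
  refine Finset.Subset.antisymm (initSeg_subset w _) fun x hx => ?_
  obtain ⟨j, rfl⟩ := exists_coe_eq w hx
  exact (coe_mem_initSeg w _ _).2 (Fin.le_last j)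

theorem initSeg_mem_flag (w : Fin (n + 1) ≃ X) (i : Fin (n + 1)) : initSeg w i ∈ flag w :=
  Finset.mem_image_of_mem _ (Finset.mem_univ i)

theorem mem_flag {w : Fin (n + 1) ≃ X} {a : Finset V} :
    a ∈ flag w ↔ ∃ i, initSeg w i = a := by
  simp [flag]

theorem initSeg_mem_flag_iff {w w' : Fin (n + 1) ≃ X} {i : Fin (n + 1)} :
    initSeg w i ∈ flag w' ↔ initSeg w' i = initSeg w i := by
  refine ⟨fun h => ?_, fun h => h ▸ initSeg_mem_flag w' i⟩
  obtain ⟨j, hj⟩ := mem_flag.1 h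
  have := congrArg Finset.card hj
  rw [card_initSeg, card_initSeg] at this
  rw [← hj, show i = j from Fin.ext (by omega)]

theorem powerset_ne_empty (X : Finset V) : X.powerset ≠ ∅ :=
  Finset.nonempty_iff_ne_empty.1 ⟨∅, by simp⟩

theorem flag_mem_sd (w : Fin (n + 1) ≃ X) : flag w ∈ sd X.powerset := by
  refine (mem_sd (powerset_ne_empty X)).2 ⟨fun a ha => ?_, fun a ha b hb => ?_⟩
  · obtain ⟨i, rfl⟩ := mem_flag.1 ha
    exact ⟨⟨_, (coe_mem_initSeg w i i).2 le_rfl⟩, Finset.mem_powerset.2 (initSeg_subset w i)⟩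
  · obtain ⟨i, rfl⟩ := mem_flag.1 ha
    obtain ⟨j, rfl⟩ := mem_flag.1 hb
    exact (le_total i j).imp (fun h => initSeg_mono w h) (fun h => initSeg_mono w h)

theorem eq_flag_of_flag_subset (w : Fin (n + 1) ≃ X) {c : Finset (Finset V)}
    (hc : c ∈ sd X.powerset) (h : flag w ⊆ c) : c = flag w := by
  refine (Finset.Subset.antisymm h fun a ha => ?_).symm
  obtain ⟨h1, h2⟩ := (mem_sd (powerset_ne_empty X)).1 hc
  obtain ⟨hne, haX⟩ := h1 a ha
  have hXn : X.card = n + 1 := by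
    have := card_initSeg w (Fin.last n)
    rwa [initSeg_last, Fin.val_last] at this
  have hpos := hne.card_pos
  have hle := Finset.card_le_card (Finset.mem_powerset.1 haX)
  have hcard := card_initSeg w ⟨a.card - 1, by omega⟩
  refine mem_flag.2 ⟨⟨a.card - 1, by omega⟩, ?_⟩
  rcases h2 _ ha _ (h (initSeg_mem_flag w ⟨a.card - 1, by omega⟩)) with h3 | h3
  · exact (Finset.eq_of_subset_of_card_le h3 (by rw [hcard]; simp only; omega)).symm
  · exact Finset.eq_of_subset_of_card_le h3 (by rw [hcard]; simp only; omega)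

theorem exists_monotone_enum {α : Type*} [LinearOrder α] (hX : X.card = n + 1) (g : V → α) :
    ∃ w : Fin (n + 1) ≃ X, Monotone fun i => g (w i) := by
  let e : Fin (n + 1) ≃ X := (X.equivFinOfCardEq hX).symm
  exact ⟨(Tuple.sort fun i => g (e i)).trans e, Tuple.monotone_sort fun i => g (e i)⟩

theorem exists_subset_flag (hX : X.card = n + 1) {c : Finset (Finset V)}
    (hc : c ∈ sd X.powerset) : ∃ w : Fin (n + 1) ≃ X, c ⊆ flag w := by
  obtain ⟨h1, h2⟩ := (mem_sd (powerset_ne_empty X)).1 hc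
  obtain ⟨w, hw⟩ := exists_monotone_enum hX fun x => (c.filter fun a => x ∉ a).card
  refine ⟨w, fun a ha => ?_⟩
  obtain ⟨⟨y, hy⟩, haX⟩ := h1 a ha
  have hdown : ∀ i j, i ≤ j → (w j : V) ∈ a → (w i : V) ∈ a := by
    intro i j hij hj
    by_contra hi
    refine (hw hij).not_gt (Finset.card_lt_card ⟨fun b hb => ?_, fun h => ?_⟩)
    · obtain ⟨hb, hjb⟩ := Finset.mem_filter.1 hb
      rcases h2 a ha b hb with h | h
      · exact absurd (h hj) hjb
      · exact Finset.mem_filter.2 ⟨hb, fun h' => hi (h h')⟩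
    · exact (Finset.mem_filter.1 (h (Finset.mem_filter.2 ⟨ha, hi⟩))).2 hj
  obtain ⟨j, rfl⟩ := exists_coe_eq w (Finset.mem_powerset.1 haX hy)
  obtain ⟨k, hk, hmax⟩ := Finset.exists_max_image
    (Finset.univ.filter fun i => (w i : V) ∈ a) id ⟨j, by simpa using hy⟩
  refine mem_flag.2 ⟨k, Finset.ext fun x => ⟨fun hx => ?_, fun hx => ?_⟩⟩
  · obtain ⟨i, rfl⟩ := exists_coe_eq w (initSeg_subset w k hx)
    exact hdown _ _ ((coe_mem_initSeg w k i).1 hx) (Finset.mem_filter.1 hk).2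
  · obtain ⟨i, rfl⟩ := exists_coe_eq w (Finset.mem_powerset.1 haX hx)
    exact (coe_mem_initSeg w k i).2 (hmax i (by simpa using hx))

/-- Keys for recursive atom orderings: `key x` orders the elements which follow the initial
element `x`, and `x ↦ key x x` orders the initial elements. -/
structure IsKey (X : Finset V) (key : V → V → ℕ) : Prop where
  inj : ∀ x ∈ X, Set.InjOn (key x) X
  inj_diag : Set.InjOn (fun x => key x x) X
  lt_iff : ∀ x ∈ X, ∀ y ∈ X, key x y < key x x ↔ key y y < key x x

/-- Descents of an enumeration. -/
def IsDescent (key : V → V → ℕ) (w : Fin (n + 1) ≃ X) (i : Fin n) : Prop :=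
  key (w 0) (w i.succ) < key (w 0) (w i.castSucc)

instance (key : V → V → ℕ) (w : Fin (n + 1) ≃ X) : DecidablePred (IsDescent key w) :=
  fun _ => inferInstanceAs (Decidable (_ < _))

/-- The subflag of an enumeration placed at its descents. -/
def descentFlag (key : V → V → ℕ) (w : Fin (n + 1) ≃ X) : Finset (Finset V) :=
  (Finset.univ.filter (IsDescent key w)).image fun i => initSeg w i.castSucc

theorem descentFlag_subset (key : V → V → ℕ) (w : Fin (n + 1) ≃ X) :
    descentFlag key w ⊆ flag w := by
  intro a ha
  obtain ⟨i, -, rfl⟩ := Finset.mem_image.1 ha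
  exact initSeg_mem_flag w _

theorem initSeg_castSucc_mem_descentFlag {key : V → V → ℕ} {w : Fin (n + 1) ≃ X} {i : Fin n} :
    initSeg w i.castSucc ∈ descentFlag key w ↔ IsDescent key w i := by
  simp only [descentFlag, Finset.mem_image, Finset.mem_filter, Finset.mem_univ, true_and]
  exact ⟨fun ⟨j, hj, h⟩ => Fin.castSucc_injective n (initSeg_injective w h) ▸ hj,
    fun h => ⟨i, h, rfl⟩⟩

theorem initSeg_last_notMem_descentFlag (key : V → V → ℕ) (w : Fin (n + 1) ≃ X) :
    initSeg w (Fin.last n) ∉ descentFlag key w := by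
  simp only [descentFlag, Finset.mem_image, not_exists, not_and]
  intro i _ h
  exact (Fin.castSucc_lt_last i).ne (initSeg_injective w h)

theorem card_descentFlag (key : V → V → ℕ) (w : Fin (n + 1) ≃ X) :
    (descentFlag key w).card = (Finset.univ.filter (IsDescent key w)).card :=
  Finset.card_image_of_injective _ ((initSeg_injective w).comp (Fin.castSucc_injective n))

/-- The lexicographic score of an enumeration. -/
def score (key : V → V → ℕ) (w : Fin (n + 1) ≃ X) : Lex (Fin (n + 1) → ℕ) :=
  toLex fun i => key (w 0) (w i)

theorem score_lt_iff {key : V → V → ℕ} {w w' : Fin (n + 1) ≃ X} :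
    score key w < score key w' ↔ ∃ i, (∀ j < i, key (w 0) (w j) = key (w' 0) (w' j)) ∧
      key (w 0) (w i) < key (w' 0) (w' i) := Iff.rfl

theorem score_injective {key : V → V → ℕ} (hkey : IsKey X key) :
    Function.Injective (score key : (Fin (n + 1) ≃ X) → _) := by
  intro w w' h
  have h' : ∀ i, key (w 0) (w i) = key (w' 0) (w' i) := fun i => congrFun h i
  have h0 : (w 0 : V) = w' 0 := hkey.inj_diag (w 0).2 (w' 0).2 (h' 0)
  refine Equiv.ext fun i => Subtype.ext (hkey.inj _ (w 0).2 (w i).2 (w' i).2 ?_)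
  rw [h' i, h0]

theorem exists_score_lt_of_mem_descentFlag {key : V → V → ℕ} (hkey : IsKey X key)
    {w : Fin (n + 1) ≃ X} {a : Finset V} (ha : a ∈ descentFlag key w) :
    ∃ w' : Fin (n + 1) ≃ X, score key w' < score key w ∧ (flag w).erase a ⊆ flag w' := by
  obtain ⟨i, hi, rfl⟩ := Finset.mem_image.1 ha
  have hi : IsDescent key w i := (Finset.mem_filter.1 hi).2
  let w' : Fin (n + 1) ≃ X := (Equiv.swap i.castSucc i.succ).trans w
  have hw' : ∀ j, w' j = w (Equiv.swap i.castSucc i.succ j) := fun j => rfl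
  have hlt : ∀ j < i.castSucc, w' j = w j := fun j hj => by
    rw [hw', Equiv.swap_apply_of_ne_of_ne hj.ne (hj.trans Fin.castSucc_lt_succ).ne]
  refine ⟨w', score_lt_iff.2 ⟨i.castSucc, ?_, ?_⟩, ?_⟩
  · intro j hj
    rw [hlt j hj, hlt 0 (lt_of_le_of_lt (Fin.zero_le j) hj)]
  · have h1 : w' i.castSucc = w i.succ := by rw [hw', Equiv.swap_apply_left]
    rcases eq_or_ne i.castSucc 0 with h0 | h0
    · rw [h0] at h1 ⊢
      rw [h1]
      unfold IsDescent at hi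
      rw [h0] at hi
      exact (hkey.lt_iff _ (w 0).2 _ (w i.succ).2).1 hi
    · rw [h1, hlt 0 (Fin.pos_iff_ne_zero.2 h0)]
      exact hi
  · intro b hb
    obtain ⟨hbi, hb⟩ := Finset.mem_erase.1 hb
    obtain ⟨k, rfl⟩ := mem_flag.1 hb
    have hk : k ≠ i.castSucc := fun h => hbi (h ▸ rfl)
    have hswap : ∀ j, Equiv.swap i.castSucc i.succ j ≤ k ↔ j ≤ k := by
      intro j
      have hk' : (k : ℕ) ≠ i := fun h => hk (Fin.ext h)
      rcases eq_or_ne j i.castSucc with rfl | h1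
      · rw [Equiv.swap_apply_left, Fin.le_def, Fin.le_def, Fin.val_succ, Fin.val_castSucc]
        omega
      rcases eq_or_ne j i.succ with rfl | h2
      · rw [Equiv.swap_apply_right, Fin.le_def, Fin.le_def, Fin.val_succ, Fin.val_castSucc]
        omega
      · rw [Equiv.swap_apply_of_ne_of_ne h1 h2]
    rw [initSeg_mem_flag_iff]
    ext x
    by_cases hx : x ∈ X
    · obtain ⟨j, rfl⟩ := exists_coe_eq w' hx
      rw [coe_mem_initSeg, hw', coe_mem_initSeg, hswap]
    · exact iff_of_false (fun h => hx (initSeg_subset _ _ h)) fun h => hx (initSeg_subset _ _ h)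

theorem exists_mem_descentFlag_of_score_lt {key : V → V → ℕ} (hkey : IsKey X key)
    {w w' : Fin (n + 1) ≃ X} (h : score key w' < score key w) :
    ∃ a ∈ descentFlag key w, a ∉ flag w' := by
  obtain ⟨i, hj, hi⟩ := score_lt_iff.1 h
  have heq : ∀ j < i, w' j = w j := by
    intro j hji
    have h0 : (w' 0 : V) = w 0 :=
      hkey.inj_diag (w' 0).2 (w 0).2 (hj 0 (lt_of_le_of_lt (Fin.zero_le j) hji))
    have := hj j hji
    rw [h0] at this
    exact Subtype.ext (hkey.inj _ (w 0).2 (w' j).2 (w j).2 this)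
  have hlt : key (w 0) (w' i) < key (w 0) (w i) := by
    rcases eq_or_ne i 0 with rfl | h0
    · exact (hkey.lt_iff _ (w 0).2 _ (w' 0).2).2 hi
    · rwa [heq 0 (Fin.pos_iff_ne_zero.2 h0)] at hi
  obtain ⟨l, hl⟩ := w.surjective (w' i)
  have hil : i < l := by
    rcases lt_trichotomy l i with h1 | h1 | h1
    · rw [← heq l h1] at hl
      exact absurd (w'.injective hl) h1.ne
    · rw [← hl, h1] at hlt
      exact absurd hlt (lt_irrefl _)
    · exact h1
  by_contra! hcon
  have hstep : ∀ k : Fin n, i ≤ k.castSucc → k.castSucc < l →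
      key (w 0) (w k.castSucc) ≤ key (w 0) (w k.succ) := by
    intro k hik hkl
    by_contra! hk
    have h1 := initSeg_mem_flag_iff.1 (hcon _ (initSeg_castSucc_mem_descentFlag.2 hk))
    have h2 := (coe_mem_initSeg w' k.castSucc i).2 hik
    rw [h1, ← hl, coe_mem_initSeg] at h2
    exact h2.not_gt hkl
  have hmono : ∀ k : Fin (n + 1), i ≤ k → k ≤ l → key (w 0) (w i) ≤ key (w 0) (w k) := by
    intro k
    induction k using Fin.induction with
    | zero => intro hik _; rw [Fin.le_zero_iff.1 hik]
    | succ k ih =>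
      intro hik hkl
      rcases hik.eq_or_lt with h1 | h1
      · rw [h1]
      · have h2 : i ≤ k.castSucc := Fin.le_castSucc_iff.2 h1
        have h3 : k.castSucc < l := lt_of_lt_of_le Fin.castSucc_lt_succ hkl
        exact (ih h2 h3.le).trans (hstep k h2 h3)
  have := hmono l hil.le le_rfl
  rw [hl] at this
  exact this.not_gt hlt

/-- A ranking of `X` by natural numbers less than `M` for which `θ` comes first. -/
structure IsRanking (X θ : Finset V) (r : V → ℕ) (M : ℕ) : Prop where
  sub : θ ⊆ X
  inj : Set.InjOn r X
  lt : ∀ x ∈ θ, ∀ y ∈ X, y ∉ θ → r x < r y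
  bound : ∀ x ∈ X, r x < M

theorem exists_isRanking {X θ : Finset V} (h : θ ⊆ X) : ∃ r M, IsRanking X θ r M := by
  let s : V → ℕ := fun x => if hx : x ∈ X then X.equivFin ⟨x, hx⟩ else 0
  have hs : ∀ x (hx : x ∈ X), s x = X.equivFin ⟨x, hx⟩ := fun x hx => dif_pos hx
  have hsb : ∀ x ∈ X, s x < X.card := fun x hx => by
    rw [hs x hx]
    exact (X.equivFin ⟨x, hx⟩).2
  have hsi : ∀ x ∈ X, ∀ y ∈ X, s x = s y → x = y := by
    intro x hx y hy hxy
    rw [hs x hx, hs y hy] at hxy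
    exact congrArg Subtype.val (X.equivFin.injective (Fin.ext hxy))
  refine ⟨fun x => if x ∈ θ then s x else X.card + s x, 2 * X.card, h, ?_, ?_, ?_⟩
  · intro x hx y hy hxy
    have h1 := hsb x hx
    have h2 := hsb y hy
    refine hsi x hx y hy ?_
    simp only at hxy
    split_ifs at hxy <;> omega
  · intro x hx y hy hyθ
    have h1 := hsb x (h hx)
    simp only [hx, hyθ, if_true, if_false]
    omega
  · intro x hx
    have h1 := hsb x hx
    split_ifs <;> omega

/-- The elements outside `θ` which are lower than the initial element `x ∉ θ` are moved before
`θ`. -/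
def nbhdKey (θ : Finset V) (r : V → ℕ) (M : ℕ) (x y : V) : ℕ :=
  if x ∉ θ ∧ y ∉ θ ∧ r y < r x then r y else M + r y

theorem nbhdKey_self (θ : Finset V) (r : V → ℕ) (M : ℕ) (x : V) :
    nbhdKey θ r M x x = M + r x := by
  simp [nbhdKey]

theorem nbhdKey_of_left_mem {θ : Finset V} (r : V → ℕ) (M : ℕ) {x : V} (hx : x ∈ θ) (y : V) :
    nbhdKey θ r M x y = M + r y := by
  simp [nbhdKey, hx]

theorem nbhdKey_of_right_mem {θ : Finset V} (r : V → ℕ) (M : ℕ) {y : V} (hy : y ∈ θ) (x : V) :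
    nbhdKey θ r M x y = M + r y := by
  simp [nbhdKey, hy]

namespace IsRanking

variable {θ : Finset V} {r : V → ℕ} {M : ℕ}

theorem isKey (h : IsRanking X θ r M) : IsKey X (nbhdKey θ r M) := by
  refine ⟨fun x hx y hy z hz hyz => h.inj hy hz ?_, fun x hx y hy hxy => h.inj hx hy ?_, ?_⟩
  · have h1 := h.bound y hy
    have h2 := h.bound z hz
    unfold nbhdKey at hyz
    split_ifs at hyz <;> omega
  · simp only [nbhdKey_self] at hxy
    omega
  · intro x hx y hy
    have h1 := h.bound y hy
    rw [nbhdKey_self, nbhdKey_self]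
    unfold nbhdKey
    split_ifs <;> omega

/-- An enumeration is critical when its descents occur exactly as long as `θ` is not covered. -/
def IsCrit (θ : Finset V) (r : V → ℕ) (M : ℕ) (w : Fin (n + 1) ≃ X) : Prop :=
  ∀ i : Fin n, IsDescent (nbhdKey θ r M) w i ↔ ¬ θ ⊆ initSeg w i.castSucc

theorem descentFlag_eq_filter_iff {w : Fin (n + 1) ≃ X} (hθX : θ ⊆ X) :
    descentFlag (nbhdKey θ r M) w = (flag w).filter (fun a => ¬ θ ⊆ a) ↔ IsCrit θ r M w := by
  constructor
  · intro h i
    rw [← initSeg_castSucc_mem_descentFlag, h, Finset.mem_filter]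
    exact and_iff_right (initSeg_mem_flag w _)
  · intro h
    ext a
    rw [Finset.mem_filter]
    by_cases ha : a ∈ flag w
    · obtain ⟨i, rfl⟩ := mem_flag.1 ha
      rw [and_iff_right ha]
      induction i using Fin.lastCases with
      | last =>
        rw [initSeg_last]
        have := initSeg_last_notMem_descentFlag (nbhdKey θ r M) w
        rw [initSeg_last] at this
        exact iff_of_false this (not_not.2 hθX)
      | cast i => rw [initSeg_castSucc_mem_descentFlag, h i]
    · exact iff_of_false (fun h' => ha (descentFlag_subset _ _ h')) fun h' => ha h'.1

theorem exists_last_mem (hθX : θ ⊆ X) (hθ : θ.Nonempty) (w : Fin (n + 1) ≃ X) :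
    ∃ l, (w l : V) ∈ θ ∧ ∀ i, (w i : V) ∈ θ → i ≤ l := by
  obtain ⟨y, hy⟩ := hθ
  obtain ⟨j, rfl⟩ := exists_coe_eq w (hθX hy)
  obtain ⟨k, hk, hmax⟩ := Finset.exists_max_image
    (Finset.univ.filter fun i => (w i : V) ∈ θ) id ⟨j, by simpa using hy⟩
  exact ⟨k, (Finset.mem_filter.1 hk).2, fun i hi => hmax i (by simpa using hi)⟩

theorem subset_initSeg_iff (hθX : θ ⊆ X) {w : Fin (n + 1) ≃ X} {l : Fin (n + 1)}
    (hl : (w l : V) ∈ θ) (hmax : ∀ i, (w i : V) ∈ θ → i ≤ l) (i : Fin (n + 1)) :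
    θ ⊆ initSeg w i ↔ l ≤ i := by
  refine ⟨fun h => (coe_mem_initSeg w i l).1 (h hl), fun h y hy => ?_⟩
  obtain ⟨j, rfl⟩ := exists_coe_eq w (hθX hy)
  exact (coe_mem_initSeg w i j).2 ((hmax j hy).trans h)

section crit

variable {w : Fin (n + 1) ≃ X} {l : Fin (n + 1)}

theorem key_antitone (hw : ∀ i : Fin n, IsDescent (nbhdKey θ r M) w i ↔ i.castSucc < l)
    {i j : Fin (n + 1)} (hij : i ≤ j) (hjl : j ≤ l) :
    nbhdKey θ r M (w 0) (w j) ≤ nbhdKey θ r M (w 0) (w i) := by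
  induction j using Fin.induction with
  | zero => rw [Fin.le_zero_iff.1 hij]
  | succ j ih =>
    rcases hij.eq_or_lt with h1 | h1
    · rw [h1]
    · have h3 : j.castSucc < l := lt_of_lt_of_le Fin.castSucc_lt_succ hjl
      exact (((hw j).2 h3).le).trans (ih (Fin.le_castSucc_iff.2 h1) h3.le)

theorem key_monotone (hw : ∀ i : Fin n, IsDescent (nbhdKey θ r M) w i ↔ i.castSucc < l)
    {j : Fin (n + 1)} (hlj : l ≤ j) :
    nbhdKey θ r M (w 0) (w l) ≤ nbhdKey θ r M (w 0) (w j) := by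
  induction j using Fin.induction with
  | zero => rw [Fin.le_zero_iff.1 hlj]
  | succ j ih =>
    rcases hlj.eq_or_lt with h1 | h1
    · rw [h1]
    · have h2 : l ≤ j.castSucc := Fin.le_castSucc_iff.2 h1
      exact (ih h2).trans (not_lt.1 fun h => h2.not_gt ((hw j).1 h))

theorem crit_descent_iff (h : IsRanking X θ r M) (hθ : θ.Nonempty) (hw : IsCrit θ r M w) :
    ∃ l, (w l : V) ∈ θ ∧ (∀ i, (w i : V) ∈ θ → i ≤ l) ∧
      ∀ i : Fin n, IsDescent (nbhdKey θ r M) w i ↔ i.castSucc < l := by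
  obtain ⟨l, hl, hmax⟩ := exists_last_mem h.sub hθ w
  exact ⟨l, hl, hmax, fun i => by rw [hw i, subset_initSeg_iff h.sub hl hmax, not_le]⟩

theorem isDescent_iff_of_isCrit (h : IsRanking X θ r M) (hθ : θ.Nonempty)
    (hw : IsCrit θ r M w) (i : Fin n) :
    IsDescent (nbhdKey θ r M) w i ↔ (w i.succ : V) ∈ θ := by
  obtain ⟨l, hl, hmax, hd⟩ := crit_descent_iff h hθ hw
  rw [hd i]
  refine ⟨fun hi => ?_, fun hi => lt_of_lt_of_le Fin.castSucc_lt_succ (hmax _ hi)⟩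
  by_contra hn
  have hil : i.succ ≤ l := Fin.castSucc_lt_iff_succ_le.1 hi
  have h1 := key_antitone hd hil le_rfl
  have h2 := lt_of_lt_of_le ((hd i).2 hi) (key_antitone hd (Fin.zero_le i.castSucc) hi.le)
  rw [nbhdKey_self] at h2
  rw [nbhdKey_of_right_mem r M hl] at h1
  have hb := h.bound _ (w i.succ).2
  by_cases h0 : (w 0 : V) ∈ θ
  · have := h.lt _ h0 _ (w i.succ).2 hn
    rw [nbhdKey_of_left_mem r M h0] at h2
    omega
  · unfold nbhdKey at h1 h2
    simp only [h0, hn, not_false_eq_true, true_and] at h1 h2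
    split_ifs at h1 h2 <;> omega

theorem rank_zero_le_of_isCrit (h : IsRanking X θ r M) (hθ : θ.Nonempty)
    (hw : IsCrit θ r M w) (h0 : (w 0 : V) ∉ θ) {y : V} (hy : y ∈ X) (hyθ : y ∉ θ) :
    r (w 0) ≤ r y := by
  obtain ⟨l, hl, hmax, hd⟩ := crit_descent_iff h hθ hw
  by_contra! hlt
  obtain ⟨j, rfl⟩ := exists_coe_eq w hy
  have h1 : nbhdKey θ r M (w 0) (w l) ≤ nbhdKey θ r M (w 0) (w j) := by
    rcases le_total j l with h2 | h2
    · exact key_antitone hd h2 le_rfl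
    · exact key_monotone hd h2
  rw [nbhdKey_of_right_mem r M hl, nbhdKey, if_pos ⟨h0, hyθ, hlt⟩] at h1
  have := h.bound _ hy
  omega

end crit

/-- The function sorting critical enumerations: `x₀` if it is not in `θ`, then `θ` in decreasing
order, then the other elements in increasing order. -/
def critRank (θ : Finset V) (r : V → ℕ) (M : ℕ) (x₀ y : V) : ℤ :=
  if y ∈ θ then -(r y : ℤ) - 1 else if y = x₀ then -(M : ℤ) - 1 else r y

theorem critRank_injOn (h : IsRanking X θ r M) (x₀ : V) :
    Set.InjOn (critRank θ r M x₀) X := by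
  intro x hx y hy hxy
  have h1 := h.bound x hx
  have h2 := h.bound y hy
  by_cases he : x = x₀ ∧ y = x₀
  · rw [he.1, he.2]
  refine h.inj hx hy ?_
  unfold critRank at hxy
  split_ifs at hxy <;> first | omega | (exfalso; tauto)

theorem nbhdKey_eq_of_min {x₀ : V} (hx₀ : x₀ ∈ θ ∨ ∀ y ∈ X, y ∉ θ → r x₀ ≤ r y)
    {y : V} (hy : y ∈ X) : nbhdKey θ r M x₀ y = M + r y := by
  refine if_neg ?_
  rintro ⟨h1, h2, h3⟩
  rcases hx₀ with h4 | h4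
  · exact h1 h4
  · exact absurd (h4 y hy h2) (by omega)

theorem strictMono_critRank (h : IsRanking X θ r M) (hθ : θ.Nonempty)
    {w : Fin (n + 1) ≃ X} (hw : IsCrit θ r M w) {x₀ : V}
    (hx₀ : x₀ = w 0 ∨ x₀ ∈ θ ∧ (w 0 : V) ∈ θ) :
    StrictMono fun i => critRank θ r M x₀ (w i) := by
  refine Fin.strictMono_iff_lt_succ.2 fun i => ?_
  have hmin : (w 0 : V) ∈ θ ∨ ∀ y ∈ X, y ∉ θ → r (w 0) ≤ r y :=
    or_iff_not_imp_left.2 fun h0 y hy hyθ => rank_zero_le_of_isCrit h hθ hw h0 hy hyθ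
  have hb1 := h.bound _ (w i.castSucc).2
  have hb2 := h.bound _ (w i.succ).2
  have hiff := isDescent_iff_of_isCrit h hθ hw i
  have hd : IsDescent (nbhdKey θ r M) w i ↔ r (w i.succ) < r (w i.castSucc) := by
    unfold IsDescent
    rw [nbhdKey_eq_of_min hmin (w i.succ).2, nbhdKey_eq_of_min hmin (w i.castSucc).2]
    omega
  rw [hd] at hiff
  have hne : r (w i.succ) ≠ r (w i.castSucc) := fun he =>
    Fin.castSucc_lt_succ.ne' (coe_injective w (h.inj (w i.succ).2 (w i.castSucc).2 he))
  by_cases hs : (w i.succ : V) ∈ θ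
  · have hlt := hiff.2 hs
    by_cases hc : (w i.castSucc : V) ∈ θ
    · simp only [critRank, hs, hc, if_true]
      omega
    · have h0 : i.castSucc = 0 := by
        by_contra hne0
        obtain ⟨j, hj⟩ := Fin.exists_succ_eq.2 hne0
        obtain ⟨l, hl, hmax, hdl⟩ := crit_descent_iff h hθ hw
        refine hc (hj ▸ (isDescent_iff_of_isCrit h hθ hw j).1 ((hdl j).2 ?_))
        have h1 := (hdl i).1 (hd.2 hlt)
        rw [← hj] at h1
        exact Fin.castSucc_lt_succ.trans h1
      have hx : x₀ = w 0 := hx₀.resolve_right fun h2 => hc (h0 ▸ h2.2)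
      have hb0 : ((w i.castSucc : X) : V) = x₀ := by rw [h0, hx]
      have hxθ : x₀ ∉ θ := hb0 ▸ hc
      simp only [critRank, hs, hb0, hxθ, if_true, if_false]
      omega
  · have hlt : ¬ r (w i.succ) < r (w i.castSucc) := fun h1 => hs (hiff.1 h1)
    have hs0 : (w i.succ : V) ≠ x₀ := by
      rintro rfl
      rcases hx₀ with h1 | h1
      · exact Fin.succ_ne_zero i (coe_injective w h1)
      · exact hs h1.1
    simp only [critRank, hs, hs0, if_false]
    split_ifs <;> omega

theorem isCrit_of_strictMono (h : IsRanking X θ r M) {w : Fin (n + 1) ≃ X} {x₀ : V}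
    (hw : StrictMono fun i => critRank θ r M x₀ (w i))
    (h0 : x₀ = w 0 ∨ x₀ ∈ θ ∧ (w 0 : V) ∈ θ)
    (hmin : x₀ ∈ θ ∨ ∀ y ∈ X, y ∉ θ → r x₀ ≤ r y) : IsCrit θ r M w := by
  intro i
  have hmin0 : (w 0 : V) ∈ θ ∨ ∀ y ∈ X, y ∉ θ → r (w 0) ≤ r y := by
    rcases h0 with h1 | h1
    · rwa [← h1]
    · exact Or.inl h1.2
  have hd : IsDescent (nbhdKey θ r M) w i ↔ r (w i.succ) < r (w i.castSucc) := by
    unfold IsDescent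
    rw [nbhdKey_eq_of_min hmin0 (w i.succ).2, nbhdKey_eq_of_min hmin0 (w i.castSucc).2]
    omega
  rw [hd]
  have hlt : critRank θ r M x₀ (w i.castSucc) < critRank θ r M x₀ (w i.succ) :=
    hw Fin.castSucc_lt_succ
  by_cases hs : (w i.succ : V) ∈ θ
  · refine iff_of_true ?_ fun hsub =>
      Fin.castSucc_lt_succ.not_ge ((coe_mem_initSeg w _ _).1 (hsub hs))
    by_cases hc : (w i.castSucc : V) ∈ θ
    · simp only [critRank, hs, hc, if_true] at hlt
      omega
    · exact h.lt _ hs _ (w i.castSucc).2 hc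
  · have hs0 : (w i.succ : V) ≠ x₀ := by
      rintro rfl
      rcases h0 with h1 | h1
      · exact Fin.succ_ne_zero i (coe_injective w h1)
      · exact hs h1.1
    refine iff_of_false ?_ (not_not.2 fun y hy => ?_)
    · by_cases hc : (w i.castSucc : V) ∈ θ
      · exact (h.lt _ hc _ (w i.succ).2 hs).not_gt
      · by_cases hc0 : (w i.castSucc : V) = x₀
        · rw [hc0] at hc ⊢
          exact (hmin.resolve_left hc _ (w i.succ).2 hs).not_gt
        · simp only [critRank, hs, hc, hs0, hc0, if_false] at hlt
          omega
    · obtain ⟨j, rfl⟩ := exists_coe_eq w (h.sub hy)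
      rw [coe_mem_initSeg]
      by_contra! hij
      have h1 := hw.monotone (Fin.castSucc_lt_iff_succ_le.1 hij)
      simp only [critRank, hs, hs0, hy, if_true, if_false] at h1
      omega

theorem exists_isCrit (h : IsRanking X θ r M) (hX : X.card = n + 1) {x₀ : V} (hx₀ : x₀ ∈ X)
    (hmin : x₀ ∈ θ ∨ ∀ y ∈ X, y ∉ θ → r x₀ ≤ r y) :
    ∃ w : Fin (n + 1) ≃ X, IsCrit θ r M w ∧ ((w 0 : V) ∈ θ ↔ x₀ ∈ θ) := by
  obtain ⟨w, hw⟩ := exists_monotone_enum hX (critRank θ r M x₀)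
  have hstrict : StrictMono fun i => critRank θ r M x₀ (w i) :=
    hw.strictMono_of_injective fun i j hij =>
      coe_injective w (critRank_injOn h x₀ (w i).2 (w j).2 hij)
  obtain ⟨j, hj⟩ := exists_coe_eq w hx₀
  have hle := hw (Fin.zero_le j)
  simp only [hj] at hle
  have hb := h.bound _ (w 0).2
  have h0 : x₀ = w 0 ∨ x₀ ∈ θ ∧ (w 0 : V) ∈ θ := by
    by_contra! hcon
    have h1 : (w 0 : V) ≠ x₀ := fun h2 => hcon.1 h2.symm
    by_cases h2 : x₀ ∈ θ
    · simp only [critRank, h2, hcon.2 h2, h1, if_true, if_false] at hle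
      omega
    · simp only [critRank, h2, h1, if_true, if_false] at hle
      split_ifs at hle <;> omega
  refine ⟨w, isCrit_of_strictMono h hstrict h0 hmin, ?_⟩
  rcases h0 with h1 | h1
  · rw [h1]
  · exact iff_of_true h1.2 h1.1

theorem eq_of_isCrit (h : IsRanking X θ r M) (hθ : θ.Nonempty) {w w' : Fin (n + 1) ≃ X}
    (hw : IsCrit θ r M w) (hw' : IsCrit θ r M w') (h0 : (w 0 : V) ∈ θ ↔ (w' 0 : V) ∈ θ) :
    w = w' := by
  have hx : (w 0 : V) = w' 0 ∨ (w 0 : V) ∈ θ ∧ (w' 0 : V) ∈ θ := by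
    by_cases h1 : (w 0 : V) ∈ θ
    · exact Or.inr ⟨h1, h0.1 h1⟩
    · have h2 : (w' 0 : V) ∉ θ := fun h3 => h1 (h0.2 h3)
      exact Or.inl (h.inj (w 0).2 (w' 0).2 (le_antisymm
        (rank_zero_le_of_isCrit h hθ hw h1 (w' 0).2 h2)
        (rank_zero_le_of_isCrit h hθ hw' h2 (w 0).2 h1)))
  have h1 := strictMono_critRank h hθ hw (Or.inl rfl)
  have h2 := strictMono_critRank h hθ hw' hx
  have h3 := (StrictMono.range_inj h1 h2).1 (by
    have hr : ∀ v : Fin (n + 1) ≃ X, Set.range (fun i => critRank θ r M (w 0) (v i)) =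
        Set.range fun x : X => critRank θ r M (w 0) x := fun v =>
      v.surjective.range_comp fun x : X => critRank θ r M (w 0) x
    rw [hr, hr])
  exact Equiv.ext fun i => Subtype.ext
    (critRank_injOn h (w 0) (w i).2 (w' i).2 (congrFun h3 i))

theorem card_descentFlag_of_isCrit (h : IsRanking X θ r M) (hθ : θ.Nonempty)
    {w : Fin (n + 1) ≃ X} (hw : IsCrit θ r M w) :
    (descentFlag (nbhdKey θ r M) w).card = (θ.erase (w 0)).card := by
  rw [card_descentFlag, ← Finset.card_image_of_injective (f := fun i : Fin n => (w i.succ : V)) _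
    ((coe_injective w).comp (Fin.succ_injective n))]
  congr 1
  ext y
  simp only [Finset.mem_image, Finset.mem_filter, Finset.mem_univ, true_and, Finset.mem_erase,
    isDescent_iff_of_isCrit h hθ hw]
  constructor
  · rintro ⟨i, hi, rfl⟩
    exact ⟨fun h1 => Fin.succ_ne_zero i (coe_injective w h1), hi⟩
  · rintro ⟨h1, h2⟩
    obtain ⟨j, rfl⟩ := exists_coe_eq w (h.sub h2)
    obtain ⟨i, rfl⟩ := Fin.exists_succ_eq.2 (show j ≠ 0 from fun h3 => h1 (h3 ▸ rfl))
    exact ⟨i, h2, rfl⟩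

theorem score_lt_of_mem_of_notMem (h : IsRanking X θ r M) {w w' : Fin (n + 1) ≃ X}
    (hw : (w 0 : V) ∈ θ) (hw' : (w' 0 : V) ∉ θ) :
    score (nbhdKey θ r M) w < score (nbhdKey θ r M) w' := by
  refine score_lt_iff.2 ⟨0, fun j hj => absurd hj (Fin.not_lt_zero j), ?_⟩
  rw [nbhdKey_self, nbhdKey_self]
  exact Nat.add_lt_add_left (h.lt _ hw _ (w' 0).2 hw') M

end IsRanking

end flags

theorem mem_openT_join_closedT_K {θ τ s : Finset V} :
    s ∈ ((openT θ).join (closedT τ)).K ↔ s ⊆ θ ∪ τ := by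
  simp only [RelCplx.join, openT, closedT, joinF, Finset.mem_image, Finset.mem_product,
    Finset.mem_powerset, Prod.exists]
  constructor
  · rintro ⟨a, b, ⟨ha, hb⟩, rfl⟩
    exact Finset.union_subset_union ha hb
  · intro hs
    refine ⟨s ∩ θ, s ∩ τ, ⟨Finset.inter_subset_right, Finset.inter_subset_right⟩, ?_⟩
    rw [← Finset.inter_union_distrib_left, Finset.inter_eq_left.2 hs]

theorem mem_openT_join_closedT_L {θ τ s : Finset V} (hd : Disjoint θ τ) :
    s ∈ ((openT θ).join (closedT τ)).L ↔ s ⊆ θ ∪ τ ∧ ¬ θ ⊆ s := by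
  simp only [RelCplx.join, openT, closedT, joinF, Finset.mem_image, Finset.mem_product,
    Finset.mem_powerset, Prod.exists, Finset.mem_union, Finset.mem_erase, Finset.notMem_empty,
    and_false, false_and, exists_false, or_false]
  constructor
  · rintro ⟨a, b, ⟨⟨hne, ha⟩, hb⟩, rfl⟩
    refine ⟨Finset.union_subset_union ha hb, fun h => hne (Finset.Subset.antisymm ha ?_)⟩
    intro x hx
    rcases Finset.mem_union.1 (h hx) with h1 | h1
    · exact h1
    · exact absurd (hb h1) (Finset.disjoint_left.1 hd hx)
  · rintro ⟨hs, hθ⟩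
    refine ⟨s ∩ θ, s ∩ τ, ⟨⟨fun h => hθ (Finset.inter_eq_right.1 h),
      Finset.inter_subset_right⟩, Finset.inter_subset_right⟩, ?_⟩
    rw [← Finset.inter_union_distrib_left, Finset.inter_eq_left.2 hs]

theorem openT_join_closedT_sdR_K (θ τ : Finset V) :
    ((openT θ).join (closedT τ)).sdR.K = sd (θ ∪ τ).powerset := by
  have : ((openT θ).join (closedT τ)).K = (θ ∪ τ).powerset := by
    ext s
    rw [mem_openT_join_closedT_K, Finset.mem_powerset]
  rw [← this]
  rfl

theorem mem_openT_join_closedT_sdR_faces {θ τ : Finset V} (hθ : θ.Nonempty)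
    (hd : Disjoint θ τ) {c : Finset (Finset V)} :
    c ∈ ((openT θ).join (closedT τ)).sdR.faces ↔
      c ∈ ((openT θ).join (closedT τ)).sdR.K ∧ ∃ a ∈ c, θ ⊆ a := by
  rw [RelCplx.faces, Finset.mem_sdiff]
  refine and_congr_right fun hc => ?_
  rw [openT_join_closedT_sdR_K, mem_sd (powerset_ne_empty _)] at hc
  have hne : ((openT θ).join (closedT τ)).L ≠ ∅ := Finset.nonempty_iff_ne_empty.1
    ⟨∅, (mem_openT_join_closedT_L hd).2 ⟨Finset.empty_subset _,
      fun h => hθ.ne_empty (Finset.subset_empty.1 h)⟩⟩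
  rw [← not_iff_not, not_not]
  push Not
  refine (mem_sd hne).trans ⟨fun h a ha => ((mem_openT_join_closedT_L hd).1 (h.1 a ha).2).2,
    fun h => ⟨fun a ha => ⟨(hc.1 a ha).1, (mem_openT_join_closedT_L hd).2
      ⟨Finset.mem_powerset.1 (hc.1 a ha).2, h a ha⟩⟩, hc.2⟩⟩

theorem mem_relDerivedNbhd_openT_join_closedT {θ τ : Finset V} {c : Finset (Finset V)} :
    c ∈ relDerivedNbhd (openT θ) ((openT θ).join (closedT τ)) ↔
      c ∈ ((openT θ).join (closedT τ)).sdR.faces ∧ ∃ v ∈ θ, ∀ a ∈ c, v ∈ a := by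
  have hsupp : suppK (openT θ) = θ := by
    ext x
    simp only [suppK, openT, Finset.mem_sup, Finset.mem_powerset, id]
    exact ⟨fun ⟨s, hs, hx⟩ => hs hx, fun hx => ⟨θ, Finset.Subset.refl θ, hx⟩⟩
  rw [relDerivedNbhd, Finset.mem_inter, and_comm, hsupp, Finset.mem_biUnion]
  refine and_congr_right fun hc => exists_congr fun v => and_congr_right fun hv => ?_
  obtain ⟨hcK, hcL⟩ := Finset.mem_sdiff.1 hc
  have hstar : c ∈ (((openT θ).join (closedT τ)).sdR.starR {({v} : Finset V)}).faces ↔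
      {({v} : Finset V)} ∪ c ∈ ((openT θ).join (closedT τ)).sdR.K := by
    rw [RelCplx.faces, Finset.mem_sdiff, RelCplx.starR, star, star, Finset.mem_filter,
      Finset.mem_filter]
    simp only [hcK, hcL, true_and, false_and, not_false_eq_true, and_true]
  rw [hstar]
  rw [openT_join_closedT_sdR_K, mem_sd (powerset_ne_empty _)] at hcK ⊢
  constructor
  · intro h a ha
    rcases h.2 {v} (by simp) a (by simp [ha]) with h1 | h1
    · exact Finset.singleton_subset_iff.1 h1
    · obtain ⟨x, hx⟩ := (hcK.1 a ha).1
      rwa [← Finset.mem_singleton.1 (h1 hx)]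
  · intro h
    constructor
    · intro a ha
      rcases Finset.mem_union.1 ha with h1 | h1
      · rw [Finset.mem_singleton.1 h1]
        exact ⟨Finset.singleton_nonempty v, Finset.mem_powerset.2
          (Finset.singleton_subset_iff.2 (Finset.mem_union_left _ hv))⟩
      · exact hcK.1 a h1
    · intro a ha b hb
      rcases Finset.mem_union.1 ha with h1 | h1 <;> rcases Finset.mem_union.1 hb with h2 | h2
      · exact Or.inl (by rw [Finset.mem_singleton.1 h1, Finset.mem_singleton.1 h2])
      · exact Or.inl (by rw [Finset.mem_singleton.1 h1]; simpa using h b h2)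
      · exact Or.inr (by rw [Finset.mem_singleton.1 h2]; simpa using h a h1)
      · exact hcK.2 a h1 b h2

theorem exists_flag_of_mem_relDerivedNbhd {θ τ : Finset V} {n : ℕ}
    (hX : (θ ∪ τ).card = n + 1) {c : Finset (Finset V)}
    (hc : c ∈ relDerivedNbhd (openT θ) ((openT θ).join (closedT τ))) :
    ∃ w : Fin (n + 1) ≃ (θ ∪ τ : Finset V), (w 0 : V) ∈ θ ∧ c ⊆ flag w := by
  obtain ⟨v, hv, hstar⟩ := Finset.mem_biUnion.1 (Finset.mem_inter.1 hc).1
  have hvc : {({v} : Finset V)} ∪ c ∈ sd (θ ∪ τ).powerset := by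
    rw [← openT_join_closedT_sdR_K]
    exact (Finset.mem_filter.1 (Finset.mem_sdiff.1 hstar).1).2
  obtain ⟨w, hw⟩ := exists_subset_flag hX hvc
  refine ⟨w, ?_, Finset.union_subset_right hw⟩
  obtain ⟨i, hi⟩ := mem_flag.1 (hw (Finset.mem_union_left _ (Finset.mem_singleton_self _)))
  have h0 := (coe_mem_initSeg w i 0).2 (Fin.zero_le i)
  rw [hi, Finset.mem_singleton] at h0
  have hsupp : suppK (openT θ) ⊆ θ := by
    intro x hx
    simp only [suppK, openT, Finset.mem_sup, Finset.mem_powerset, id] at hx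
    exact hx.elim fun s hs => hs.1 hs.2
  rw [h0]
  exact hsupp hv

theorem exists_strictMono_enum {ι α : Type*} [Fintype ι] [LinearOrder α] {s : ι → α}
    (hs : Function.Injective s) :
    ∃ (N : ℕ) (e : Fin N ≃ ι), StrictMono fun i => s (e i) := by
  let _ : LinearOrder ι := LinearOrder.lift' s hs
  let e := Fintype.orderIsoFinOfCardEq ι rfl
  exact ⟨_, e.toEquiv, fun _ _ hij => e.strictMono hij⟩

/-- **Theorem (first case).** If `T` is an open simplex and `T'` a nonempty
closed simplex (on disjoint vertex sets), then `sd(T * T')` carries a Morse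
shelling which begins with `N(T, T * T')`, uses exactly one critical tile inside
`N(T, T * T')`, of index `dim T`, exactly one critical tile outside, of index
`dim T + 1`, and no other critical tile. -/
theorem morse_shelling_of_sd_open_join_closed
    {V : Type*} [DecidableEq V] (θ τ : Finset V)
    (hθ : θ.Nonempty) (hτ : τ.Nonempty) (hd : Disjoint θ τ) :
    ∃ (N : ℕ) (Tl : Tiling (((openT θ).join (closedT τ)).sdR) N),
      Tl.IsMorse ∧ Tl.IsShelling ∧
      Tl.BeginsWith (relDerivedNbhd (openT θ) ((openT θ).join (closedT τ))) ∧
      ∃ i₁ i₂ : Fin N, i₁ ≠ i₂ ∧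
        (Tl.tile i₁).faces ⊆ relDerivedNbhd (openT θ) ((openT θ).join (closedT τ)) ∧
        (∃ n, IsCriticalTile (Tl.tile i₁) n (θ.card - 1)) ∧
        Disjoint (Tl.tile i₂).faces
          (relDerivedNbhd (openT θ) ((openT θ).join (closedT τ))) ∧
        (∃ n, IsCriticalTile (Tl.tile i₂) n θ.card) ∧
        ∀ i : Fin N, (∃ n k, IsCriticalTile (Tl.tile i) n k) → i = i₁ ∨ i = i₂ := by
  classical
  obtain ⟨n, hX⟩ : ∃ n, (θ ∪ τ).card = n + 1 :=
    Nat.exists_eq_succ_of_ne_zero (hθ.mono Finset.subset_union_left).card_pos.ne'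
  obtain ⟨r, M, hr⟩ := exists_isRanking (Finset.subset_union_left : θ ⊆ θ ∪ τ)
  have hkey := hr.isKey
  obtain ⟨N, e, he⟩ := exists_strictMono_enum
    (score_injective hkey : Function.Injective
      (score (nbhdKey θ r M) : (Fin (n + 1) ≃ (θ ∪ τ : Finset V)) → _))
  have hlt : ∀ i j, score (nbhdKey θ r M) (e i) < score (nbhdKey θ r M) (e j) ↔ i < j :=
    fun i j => he.lt_iff_lt
  have htop : ∀ w : Fin (n + 1) ≃ (θ ∪ τ : Finset V), ∃ a ∈ flag w, θ ⊆ a := fun w =>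
    ⟨_, initSeg_mem_flag w (Fin.last n), by
      rw [initSeg_last]
      exact Finset.subset_union_left⟩
  have hflag : ∀ w : Fin (n + 1) ≃ (θ ∪ τ : Finset V),
      flag w ∈ ((openT θ).join (closedT τ)).sdR.K := fun w => by
    rw [openT_join_closedT_sdR_K]
    exact flag_mem_sd w
  obtain ⟨T, hshell, htile⟩ := exists_tiling_resTile
    (S := ((openT θ).join (closedT τ)).sdR) (f := fun i => flag (e i))
    (r := fun i => descentFlag (nbhdKey θ r M) (e i)) (P := fun a => θ ⊆ a)
    (isComplex_sd _) (isComplex_sd _)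
    (fun c => mem_openT_join_closedT_sdR_faces hθ hd)
    (fun i => ⟨hflag _, fun c hc h => by
      rw [openT_join_closedT_sdR_K] at hc
      exact eq_flag_of_flag_subset _ hc h⟩)
    (fun c hc => by
      rw [openT_join_closedT_sdR_K] at hc
      obtain ⟨w, hw⟩ := exists_subset_flag hX hc
      exact ⟨e.symm w, by simpa using hw⟩)
    (fun i v hv => by
      obtain ⟨w, hw, hsub⟩ := exists_score_lt_of_mem_descentFlag hkey hv
      refine ⟨e.symm w, ?_, by simpa using hsub⟩
      rw [← hlt]
      simpa using hw)
    (fun i j hj => exists_mem_descentFlag_of_score_lt hkey ((hlt j i).2 hj))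
  have hface : ∀ i c, c ∈ (T.tile i).faces ↔ c ⊆ flag (e i) ∧
      descentFlag (nbhdKey θ r M) (e i) ⊆ c ∧ ∃ a ∈ c, θ ⊆ a := fun i c => by
    rw [htile, mem_resTile_faces]
  have hfaceS : ∀ i, ∀ c ∈ (T.tile i).faces, c ∈ ((openT θ).join (closedT τ)).sdR.faces := by
    intro i c hc
    obtain ⟨h1, -, h3⟩ := (hface i c).1 hc
    exact (mem_openT_join_closedT_sdR_faces hθ hd).2 ⟨isComplex_sd _ _ (hflag (e i)) _ h1, h3⟩
  have hinside : ∀ i, (e i 0 : V) ∈ θ →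
      (T.tile i).faces ⊆ relDerivedNbhd (openT θ) ((openT θ).join (closedT τ)) := by
    intro i hi c hc
    refine mem_relDerivedNbhd_openT_join_closedT.2 ⟨hfaceS i c hc, _, hi, fun a ha => ?_⟩
    obtain ⟨k, rfl⟩ := mem_flag.1 (((hface i c).1 hc).1 ha)
    exact (coe_mem_initSeg _ k 0).2 (Fin.zero_le k)
  have houtside : ∀ i, (e i 0 : V) ∉ θ → Disjoint (T.tile i).faces
      (relDerivedNbhd (openT θ) ((openT θ).join (closedT τ))) := by
    intro i hi
    refine Finset.disjoint_left.2 fun c hc hcN => ?_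
    obtain ⟨w, hw, hcw⟩ := exists_flag_of_mem_relDerivedNbhd hX hcN
    obtain ⟨a, ha, haw⟩ := exists_mem_descentFlag_of_score_lt hkey
      (hr.score_lt_of_mem_of_notMem hw hi)
    exact haw (hcw (((hface i c).1 hc).2.1 ha))
  have hcrit : ∀ w : Fin (n + 1) ≃ (θ ∪ τ : Finset V), IsRanking.IsCrit θ r M w →
      ∃ m, IsCriticalTile (T.tile (e.symm w)) m (θ.erase (w 0)).card := by
    intro w hw
    rw [htile, e.apply_symm_apply, ← hr.card_descentFlag_of_isCrit hθ hw]
    exact isCriticalTile_resTile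
      ((IsRanking.descentFlag_eq_filter_iff Finset.subset_union_left).2 hw) (htop w)
  have hcrit' : ∀ i, (∃ m k, IsCriticalTile (T.tile i) m k) → IsRanking.IsCrit θ r M (e i) := by
    rintro i ⟨m, k, h⟩
    rw [htile] at h
    refine (IsRanking.descentFlag_eq_filter_iff Finset.subset_union_left).1
      (eq_filter_not_of_isCriticalTile_resTile (descentFlag_subset _ _) (fun h' => ?_)
        (htop _) h)
    exact initSeg_last_notMem_descentFlag (nbhdKey θ r M) (e i)
      (h' ▸ initSeg_mem_flag (e i) (Fin.last n))
  obtain ⟨x₁, hx₁⟩ := hθ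
  obtain ⟨x₂, hx₂, hmin⟩ := Finset.exists_min_image τ r hτ
  have hx₂θ : x₂ ∉ θ := Finset.disjoint_right.1 hd hx₂
  obtain ⟨w₁, hw₁, h₁⟩ := hr.exists_isCrit hX (Finset.mem_union_left _ hx₁) (Or.inl hx₁)
  obtain ⟨w₂, hw₂, h₂⟩ := hr.exists_isCrit hX (Finset.mem_union_right _ hx₂)
    (Or.inr fun y hy hyθ => hmin y ((Finset.mem_union.1 hy).resolve_left hyθ))
  rw [iff_true_right hx₁] at h₁
  rw [iff_false_right hx₂θ] at h₂
  have hθ : θ.Nonempty := ⟨x₁, hx₁⟩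
  refine ⟨N, T, fun i => ?_, hshell, ?_, e.symm w₁, e.symm w₂, fun h => ?_,
    hinside _ (by simpa using h₁), ?_, houtside _ (by simpa using h₂), ?_, fun i hi => ?_⟩
  · rw [htile]
    exact isMorseTile_resTile (descentFlag_subset _ _) (htop _)
  · obtain ⟨p, hp, hpθ⟩ := exists_forall_lt_iff (Q := fun i => (e i 0 : V) ∈ θ)
      fun i j hij hj => by
        by_contra hi
        exact hij.not_gt ((hlt j i).1 (hr.score_lt_of_mem_of_notMem hj hi))
    refine ⟨p, hp, Finset.ext fun c => ?_⟩
    simp only [Tiling.prefixFaces, Finset.mem_biUnion, Finset.mem_filter, Finset.mem_univ,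
      true_and]
    constructor
    · rintro ⟨i, hi, hc⟩
      exact hinside i ((hpθ i).1 hi) hc
    · intro hc
      have hcS := (mem_relDerivedNbhd_openT_join_closedT.1 hc).1
      rw [← T.cover] at hcS
      obtain ⟨i, -, hi⟩ := Finset.mem_biUnion.1 hcS
      refine ⟨i, (hpθ i).2 ?_, hi⟩
      by_contra hn
      exact Finset.disjoint_left.1 (houtside i hn) hi hc
  · exact h₂ (e.symm.injective h ▸ h₁)
  · simpa only [Finset.card_erase_of_mem h₁] using hcrit w₁ hw₁
  · simpa only [Finset.erase_eq_of_notMem h₂] using hcrit w₂ hw₂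
  · have hw := hcrit' i hi
    by_cases h : (e i 0 : V) ∈ θ
    · exact Or.inl (e.eq_symm_apply.2 (hr.eq_of_isCrit hθ hw hw₁ (iff_of_true h h₁)))
    · exact Or.inr (e.eq_symm_apply.2 (hr.eq_of_isCrit hθ hw hw₂ (iff_of_false h h₂)))

end MorseShelling
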